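/- arXiv:0912.2837 — 6 statements merged into one kernel-verified Lean document; each statement's English description precedes it below -/
import Mathlib

section
/- For every Borel measurable function x : [0,∞) → ℝ that is bounded on compact intervals, there exists exactly one Borel measurable function z : [0,∞) → ℝ, bounded on compact intervals, satisfying z(t) = x(t) + ∫_{[0,t]} (z(t−s) + a)⁺ dμ(s) for all t ≥ 0. -/
open MeasureTheory Set

/-- The renewal-type operator `z ↦ x + ∫_{[0,·]} (z (· - s) + a)⁺ dμ(s)`. -/
noncomputable def renewalMap (μ : Measure ℝ) (a : ℝ) (x z : ℝ → ℝ) (t : ℝ) : ℝ :=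
  x t + ∫ s in Icc (0 : ℝ) t, max (z (t - s) + a) 0 ∂μ

/-- Boundedness on every compact interval `[0, T]`. -/
def BddOnCompacts (z : ℝ → ℝ) : Prop :=
  ∀ T, 0 ≤ T → ∃ C, ∀ t ∈ Icc (0 : ℝ) T, |z t| ≤ C

theorem measurable_renewalMap (μ : Measure ℝ) [IsProbabilityMeasure μ] (a : ℝ) {x z : ℝ → ℝ}
    (hx : Measurable x) (hz : Measurable z) : Measurable (renewalMap μ a x z) := by
  refine hx.add ?_
  have hS : MeasurableSet {p : ℝ × ℝ | 0 ≤ p.2 ∧ p.2 ≤ p.1} :=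
    (measurableSet_le measurable_const measurable_snd).inter
      (measurableSet_le measurable_snd measurable_fst)
  have hm : Measurable ({p : ℝ × ℝ | 0 ≤ p.2 ∧ p.2 ≤ p.1}.indicator
      fun p => max (z (p.1 - p.2) + a) 0) :=
    Measurable.indicator (by fun_prop) hS
  have h := (hm.stronglyMeasurable.integral_prod_right' (ν := μ)).measurable
  convert h using 2 with t
  rw [← integral_indicator measurableSet_Icc]
  rfl

theorem integrableOn_max_shift (μ : Measure ℝ) [IsProbabilityMeasure μ] (a : ℝ) {z : ℝ → ℝ}
    (hz : Measurable z) (hb : BddOnCompacts z) {t : ℝ} (ht : 0 ≤ t) :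
    IntegrableOn (fun s => max (z (t - s) + a) 0) (Icc 0 t) μ := by
  obtain ⟨C, hC⟩ := hb t ht
  refine Measure.integrableOn_of_bounded (M := C + |a|) (measure_ne_top _ _)
    (show Measurable _ by fun_prop).aestronglyMeasurable ?_
  filter_upwards [ae_restrict_mem measurableSet_Icc] with s hs
  have h := hC (t - s) ⟨by linarith [hs.2], by linarith [hs.1]⟩
  rw [Real.norm_eq_abs, abs_of_nonneg (le_max_right _ _)]
  refine max_le ?_ ((abs_nonneg _).trans (h.trans (by linarith [abs_nonneg a])))
  linarith [le_abs_self (z (t - s)), le_abs_self a]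

theorem bddOnCompacts_renewalMap (μ : Measure ℝ) [IsProbabilityMeasure μ] (a : ℝ) {x z : ℝ → ℝ}
    (hx : BddOnCompacts x) (hz : BddOnCompacts z) : BddOnCompacts (renewalMap μ a x z) := by
  intro T hT
  obtain ⟨C, hC⟩ := hx T hT
  obtain ⟨D, hD⟩ := hz T hT
  have hD0 : 0 ≤ D := (abs_nonneg _).trans (hD 0 ⟨le_rfl, hT⟩)
  refine ⟨C + (D + |a|), fun t ht => (abs_add_le _ _).trans (add_le_add (hC t ht) ?_)⟩
  rw [← Real.norm_eq_abs]
  refine (norm_setIntegral_le_of_norm_le_const (C := D + |a|) (measure_lt_top _ _)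
    fun s hs => ?_).trans
      (mul_le_of_le_one_right (add_nonneg hD0 (abs_nonneg a)) measureReal_le_one)
  have h := hD (t - s) ⟨by linarith [hs.2], by linarith [hs.1, ht.2]⟩
  rw [Real.norm_eq_abs, abs_of_nonneg (le_max_right _ _)]
  refine max_le ?_ (add_nonneg hD0 (abs_nonneg a))
  linarith [le_abs_self (z (t - s)), le_abs_self a]

/-- The map is Lipschitz for the exponentially weighted sup norm on `[0, T]`, with constant any
bound for the Laplace transform of `μ`. -/
theorem abs_renewalMap_sub_le (μ : Measure ℝ) [IsProbabilityMeasure μ] (a : ℝ) {x f g : ℝ → ℝ}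
    {l ρ K T : ℝ} (hρ : ∀ t, ∫ s in Icc (0 : ℝ) t, Real.exp (-(l * s)) ∂μ ≤ ρ)
    (hf : Measurable f) (hfb : BddOnCompacts f) (hg : Measurable g) (hgb : BddOnCompacts g)
    (hK : 0 ≤ K) (h : ∀ u ∈ Icc (0 : ℝ) T, |f u - g u| ≤ K * Real.exp (l * u))
    {t : ℝ} (ht : t ∈ Icc (0 : ℝ) T) :
    |renewalMap μ a x f t - renewalMap μ a x g t| ≤ ρ * K * Real.exp (l * t) := by
  unfold renewalMap
  rw [add_sub_add_left_eq_sub, ← integral_sub (integrableOn_max_shift μ a hf hfb ht.1)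
    (integrableOn_max_shift μ a hg hgb ht.1), ← Real.norm_eq_abs]
  have hexp : IntegrableOn (fun s => K * Real.exp (l * t) * Real.exp (-(l * s))) (Icc 0 t) μ :=
    ContinuousOn.integrableOn_compact isCompact_Icc (by fun_prop)
  refine (norm_integral_le_of_norm_le hexp ?_).trans ?_
  · filter_upwards [ae_restrict_mem measurableSet_Icc] with s hs
    have hu := h (t - s) ⟨by linarith [hs.2], by linarith [hs.1, ht.2]⟩
    rw [Real.norm_eq_abs, mul_assoc, ← Real.exp_add]
    refine (abs_max_sub_max_le_abs _ _ _).trans ?_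
    rw [add_sub_add_right_eq_sub]
    rwa [show l * t + -(l * s) = l * (t - s) by ring]
  · rw [integral_const_mul]
    have := mul_le_mul_of_nonneg_left (hρ t) (mul_nonneg hK (Real.exp_pos (l * t)).le)
    linarith

theorem exists_laplace_le (μ : Measure ℝ) [IsProbabilityMeasure μ] {δ ε : ℝ} (hδ : 0 < δ)
    (hε : ε < 1) (hμ : μ.real (Icc 0 δ) ≤ ε) :
    ∃ l : ℝ, 0 ≤ l ∧ ∃ ρ : ℝ, ρ < 1 ∧
      ∀ t, ∫ s in Icc (0 : ℝ) t, Real.exp (-(l * s)) ∂μ ≤ ρ := by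
  have hε0 : 0 ≤ ε := measureReal_nonneg.trans hμ
  have hc : 0 < (1 - ε) / 2 := by linarith
  have hl : 0 ≤ -Real.log ((1 - ε) / 2) / δ :=
    div_nonneg (neg_nonneg.2 (Real.log_nonpos hc.le (by linarith))) hδ.le
  refine ⟨_, hl, ε + (1 - ε) / 2, by linarith, fun t => ?_⟩
  set l := -Real.log ((1 - ε) / 2) / δ with hl_def
  have hlδ : Real.exp (-(l * δ)) = (1 - ε) / 2 := by
    rw [hl_def, div_mul_cancel₀ _ hδ.ne', neg_neg, Real.exp_log hc]
  have hind : Integrable ((Icc (0 : ℝ) δ).indicator fun _ => (1 : ℝ)) (μ.restrict (Icc 0 t)) :=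
    (integrable_const 1).indicator measurableSet_Icc
  calc ∫ s in Icc (0 : ℝ) t, Real.exp (-(l * s)) ∂μ
      ≤ ∫ s in Icc (0 : ℝ) t, ((Icc (0 : ℝ) δ).indicator (fun _ => 1) s + (1 - ε) / 2) ∂μ := by
        refine setIntegral_mono_on
          (ContinuousOn.integrableOn_compact isCompact_Icc (by fun_prop))
          (hind.add (integrable_const _)) measurableSet_Icc fun s hs => ?_
        by_cases hsδ : s ≤ δ
        · rw [indicator_of_mem (show s ∈ Icc 0 δ from ⟨hs.1, hsδ⟩)]
          have : Real.exp (-(l * s)) ≤ 1 :=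
            Real.exp_le_one_iff.2 (neg_nonpos.2 (mul_nonneg hl hs.1))
          linarith
        · rw [indicator_of_notMem (fun h => hsδ h.2), zero_add, ← hlδ]
          push Not at hsδ
          gcongr
    _ = (μ.restrict (Icc 0 t)).real (Icc 0 δ) + μ.real (Icc 0 t) * ((1 - ε) / 2) := by
        rw [integral_add hind (integrable_const _), integral_indicator_const _ measurableSet_Icc]
        simp
    _ ≤ ε + (1 - ε) / 2 := by
        refine add_le_add (le_trans ?_ hμ) (mul_le_of_le_one_left hc.le measureReal_le_one)
        exact ENNReal.toReal_mono (measure_ne_top _ _) (Measure.restrict_apply_le _ _)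

theorem eq_of_renewalMap_eq (μ : Measure ℝ) [IsProbabilityMeasure μ] (a : ℝ) {x f g : ℝ → ℝ}
    {l ρ : ℝ} (hl : 0 ≤ l) (hρ1 : ρ < 1)
    (hρ : ∀ t, ∫ s in Icc (0 : ℝ) t, Real.exp (-(l * s)) ∂μ ≤ ρ)
    (hf : Measurable f) (hfb : BddOnCompacts f) (hg : Measurable g) (hgb : BddOnCompacts g)
    (hfx : ∀ t, 0 ≤ t → f t = renewalMap μ a x f t)
    (hgx : ∀ t, 0 ≤ t → g t = renewalMap μ a x g t) {T : ℝ} (hT : 0 ≤ T) : f T = g T := by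
  have hρ0 : 0 ≤ ρ := (integral_nonneg fun _ => (Real.exp_pos _).le).trans (hρ 0)
  obtain ⟨C, hC⟩ := hfb T hT
  obtain ⟨D, hD⟩ := hgb T hT
  have hCD : 0 ≤ C + D := add_nonneg ((abs_nonneg _).trans (hC 0 ⟨le_rfl, hT⟩))
    ((abs_nonneg _).trans (hD 0 ⟨le_rfl, hT⟩))
  have key : ∀ n : ℕ, ∀ u ∈ Icc (0 : ℝ) T,
      |f u - g u| ≤ ρ ^ n * (C + D) * Real.exp (l * u) := by
    intro n
    induction n with
    | zero =>
      intro u hu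
      have h1 : 1 ≤ Real.exp (l * u) := Real.one_le_exp (mul_nonneg hl hu.1)
      rw [pow_zero, one_mul]
      exact ((abs_sub _ _).trans (add_le_add (hC u hu) (hD u hu))).trans
        (le_mul_of_one_le_right hCD h1)
    | succ n ih =>
      intro u hu
      rw [hfx u hu.1, hgx u hu.1, pow_succ', mul_assoc ρ]
      exact abs_renewalMap_sub_le μ a hρ hf hfb hg hgb (by positivity) ih hu
  have hlim : Filter.Tendsto (fun n : ℕ => ρ ^ n * (C + D) * Real.exp (l * T))
      Filter.atTop (nhds 0) := by
    simpa using ((tendsto_pow_atTop_nhds_zero_of_lt_one hρ0 hρ1).mul_const (C + D)).mul_const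
      (Real.exp (l * T))
  have := ge_of_tendsto' hlim fun n => key n T ⟨hT, le_rfl⟩
  exact sub_eq_zero.1 (abs_nonpos_iff.1 this)

theorem exists_renewalMap_eq (μ : Measure ℝ) [IsProbabilityMeasure μ] (a : ℝ) {x : ℝ → ℝ}
    {l ρ : ℝ} (hl : 0 ≤ l) (hρ1 : ρ < 1)
    (hρ : ∀ t, ∫ s in Icc (0 : ℝ) t, Real.exp (-(l * s)) ∂μ ≤ ρ)
    (hx : Measurable x) (hxb : BddOnCompacts x) :
    ∃ z, Measurable z ∧ BddOnCompacts z ∧ ∀ t, 0 ≤ t → z t = renewalMap μ a x z t := by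
  have hρ0 : 0 ≤ ρ := (integral_nonneg fun _ => (Real.exp_pos _).le).trans (hρ 0)
  set F := renewalMap μ a x with hF
  set Z : ℕ → ℝ → ℝ := fun n => F^[n] x with hZ
  have hZs : ∀ n, Z (n + 1) = F (Z n) := fun n => Function.iterate_succ_apply' F n x
  have hZm : ∀ n, Measurable (Z n) := by
    intro n
    induction n with
    | zero => exact hx
    | succ n ih => rw [hZs]; exact measurable_renewalMap μ a hx ih
  have hZb : ∀ n, BddOnCompacts (Z n) := by
    intro n
    induction n with
    | zero => exact hxb
    | succ n ih => rw [hZs]; exact bddOnCompacts_renewalMap μ a hxb ih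
  have hstep : ∀ T, 0 ≤ T → ∃ C, 0 ≤ C ∧ ∀ n : ℕ, ∀ u ∈ Icc (0 : ℝ) T,
      |Z n u - Z (n + 1) u| ≤ ρ ^ n * C * Real.exp (l * u) := by
    intro T hT
    obtain ⟨C, hC⟩ := hZb 0 T hT
    obtain ⟨D, hD⟩ := hZb 1 T hT
    have hCD : 0 ≤ C + D := add_nonneg ((abs_nonneg _).trans (hC 0 ⟨le_rfl, hT⟩))
      ((abs_nonneg _).trans (hD 0 ⟨le_rfl, hT⟩))
    refine ⟨C + D, hCD, fun n => ?_⟩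
    induction n with
    | zero =>
      intro u hu
      have h1 : 1 ≤ Real.exp (l * u) := Real.one_le_exp (mul_nonneg hl hu.1)
      rw [pow_zero, one_mul]
      exact ((abs_sub _ _).trans (add_le_add (hC u hu) (hD u hu))).trans
        (le_mul_of_one_le_right hCD h1)
    | succ n ih =>
      intro u hu
      rw [hZs n, hZs (n + 1), pow_succ', mul_assoc ρ]
      exact abs_renewalMap_sub_le μ a hρ (hZm n) (hZb n) (hZm (n + 1))
        (hZb (n + 1)) (by positivity) ih hu
  have hneg : ∀ t < 0, ∀ n, Z n t = x t := by
    intro t ht n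
    cases n with
    | zero => rfl
    | succ n => rw [hZs, hF]; simp [renewalMap, Icc_eq_empty (not_le.2 ht)]
  have hconv : ∀ t, ∃ y, Filter.Tendsto (fun n => Z n t) Filter.atTop (nhds y) := by
    intro t
    rcases lt_or_ge t 0 with ht | ht
    · exact ⟨x t, by simp [hneg t ht]⟩
    · obtain ⟨C, -, hC⟩ := hstep t ht
      refine cauchySeq_tendsto_of_complete
        (cauchySeq_of_le_geometric ρ (C * Real.exp (l * t)) hρ1 fun n => ?_)
      rw [Real.dist_eq]
      exact (hC n t ⟨ht, le_rfl⟩).trans_eq (by ring)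
  choose z hz using hconv
  have hzm : Measurable z := measurable_of_tendsto_metrizable hZm (tendsto_pi_nhds.2 hz)
  have hdist : ∀ T, 0 ≤ T → ∃ C, 0 ≤ C ∧ ∀ n : ℕ, ∀ u ∈ Icc (0 : ℝ) T,
      |Z n u - z u| ≤ ρ ^ n * C * Real.exp (l * u) := by
    intro T hT
    obtain ⟨C, hC0, hC⟩ := hstep T hT
    refine ⟨C / (1 - ρ), div_nonneg hC0 (by linarith), fun n u hu => ?_⟩
    have h := dist_le_of_le_geometric_of_tendsto ρ (C * Real.exp (l * u)) hρ1
      (fun n => by rw [Real.dist_eq]; exact (hC n u hu).trans_eq (by ring)) (hz u) n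
    rw [Real.dist_eq] at h
    exact h.trans_eq (by ring)
  have hzb : BddOnCompacts z := by
    intro T hT
    obtain ⟨C, hC0, hC⟩ := hdist T hT
    obtain ⟨D, hD⟩ := hZb 0 T hT
    refine ⟨D + C * Real.exp (l * T), fun t ht => ?_⟩
    have h1 := hC 0 t ht
    rw [pow_zero, one_mul] at h1
    have h2 : C * Real.exp (l * t) ≤ C * Real.exp (l * T) := by
      gcongr
      exact ht.2
    have h3 := abs_sub_abs_le_abs_sub (z t) (Z 0 t)
    rw [abs_sub_comm] at h3
    linarith [hD t ht]
  refine ⟨z, hzm, hzb, fun t ht => ?_⟩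
  obtain ⟨C, hC0, hC⟩ := hdist t ht
  refine tendsto_nhds_unique ((hz t).comp (Filter.tendsto_add_atTop_nat 1)) ?_
  rw [tendsto_iff_dist_tendsto_zero]
  have hlim : Filter.Tendsto (fun n : ℕ => ρ * (ρ ^ n * C) * Real.exp (l * t))
      Filter.atTop (nhds 0) := by
    simpa using (((tendsto_pow_atTop_nhds_zero_of_lt_one hρ0 hρ1).mul_const C).const_mul
      ρ).mul_const (Real.exp (l * t))
  refine squeeze_zero (fun _ => dist_nonneg) (fun n => ?_) hlim
  rw [Real.dist_eq, Function.comp_apply, hZs]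
  exact abs_renewalMap_sub_le μ a hρ (hZm n) (hZb n) hzm hzb (by positivity) (hC n) ⟨ht, le_rfl⟩

/-- Proposition 3.1 (existence and uniqueness part): for every Borel measurable
function `x` on `[0,∞)` that is bounded on compact intervals, there is exactly one
Borel measurable function `z`, bounded on compact intervals, with
`z t = x t + ∫_{[0,t]} (z (t-s) + a)⁺ dμ(s)` for all `t ≥ 0`. -/
theorem stmt_1
    (μ : Measure ℝ) [IsProbabilityMeasure μ] (hμsupp : μ (Iio (0 : ℝ)) = 0)
    (a δ ε : ℝ) (hδ : 0 < δ) (hε0 : 0 < ε) (hε1 : ε < 1)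
    (hμ : ∀ y, 0 ≤ y → (μ (Icc y (y + δ))).toReal ≤ ε)
    (x : ℝ → ℝ) (hxm : Measurable x)
    (hxb : ∀ T, 0 ≤ T → ∃ C, ∀ t ∈ Icc (0 : ℝ) T, |x t| ≤ C) :
    ∃ z : ℝ → ℝ,
      (Measurable z ∧ (∀ T, 0 ≤ T → ∃ C, ∀ t ∈ Icc (0 : ℝ) T, |z t| ≤ C) ∧
        ∀ t, 0 ≤ t → z t = x t + ∫ s in Icc (0 : ℝ) t, max (z (t - s) + a) 0 ∂μ) ∧
      ∀ z' : ℝ → ℝ,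
        (Measurable z' ∧ (∀ T, 0 ≤ T → ∃ C, ∀ t ∈ Icc (0 : ℝ) T, |z' t| ≤ C) ∧
          ∀ t, 0 ≤ t → z' t = x t + ∫ s in Icc (0 : ℝ) t, max (z' (t - s) + a) 0 ∂μ) →
        ∀ t, 0 ≤ t → z' t = z t := by
  obtain ⟨l, hl, ρ, hρ1, hρ⟩ := exists_laplace_le μ hδ hε1 (by simpa [Measure.real] using hμ 0 le_rfl)
  obtain ⟨z, hzm, hzb, hz⟩ := exists_renewalMap_eq μ a hl hρ1 hρ hxm hxb
  exact ⟨z, ⟨hzm, hzb, hz⟩, fun z' ⟨hzm', hzb', hz'⟩ t ht =>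
    eq_of_renewalMap_eq μ a hl hρ1 hρ hzm' hzb' hzm hzb hz' hz ht⟩
end

section
/- Let x₁, x₂ : [0,∞) → ℝ be Borel measurable and bounded on compact intervals, and let z₁, z₂ : [0,∞) → ℝ be Borel measurable, bounded on compact intervals, and satisfy z_j(t) = x_j(t) + ∫_{[0,t]} (z_j(t−s) + a)⁺ dμ(s) for all t ≥ 0 (j = 1,2). Then for every T > 0, sup_{0 ≤ t ≤ T} |z₁(t) − z₂(t)| ≤ (1−ε)^{−⌈T/δ⌉} · sup_{0 ≤ t ≤ T} |x₁(t) − x₂(t)|. -/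
open MeasureTheory Set

/-- A measurable function bounded on `[0, t]`, reflected to `s ↦ f (t - s)`, is integrable there. -/
lemma integrableOn_comp_sub_of_bounded (μ : Measure ℝ) [IsFiniteMeasure μ] {f : ℝ → ℝ}
    (hf : Measurable f) {t C : ℝ} (hC : ∀ u ∈ Icc (0 : ℝ) t, |f u| ≤ C) :
    IntegrableOn (fun s => f (t - s)) (Icc 0 t) μ := by
  refine Measure.integrableOn_of_bounded (M := C) (measure_ne_top _ _)
    (hf.comp (measurable_const.sub measurable_id)).aestronglyMeasurable ?_
  filter_upwards [ae_restrict_mem measurableSet_Icc] with s hs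
  exact hC _ ⟨by linarith [hs.2], by linarith [hs.1]⟩

lemma mul_sum_pow_inv_one_sub {ε : ℝ} (hε : ε < 1) (k : ℕ) :
    ε * ∑ j ∈ Finset.range k, (1 - ε)⁻¹ ^ (k - j) = (1 - ε)⁻¹ ^ k - 1 := by
  have h : (1 - ε) ≠ 0 := by linarith
  induction k with
  | zero => simp
  | succ k ih =>
    rw [Finset.sum_range_succ']
    simp only [Nat.add_sub_add_right, Nat.sub_zero]
    rw [mul_add, ih, pow_succ]
    field_simp
    ring

/-- Covering `[0, t]` by windows of length `δ`, each of mass at most `ε`, bounds a convolution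
integral by `ε` times the sum of bounds on the windows. -/
lemma setIntegral_comp_sub_le_sum (μ : Measure ℝ) [IsFiniteMeasure μ] {δ ε : ℝ} (hδ : 0 < δ)
    (hμ : ∀ y, 0 ≤ y → (μ (Icc y (y + δ))).toReal ≤ ε) {f : ℝ → ℝ} (hf : Measurable f)
    {t C : ℝ} (hC : ∀ u ∈ Icc (0 : ℝ) t, |f u| ≤ C) {k : ℕ} (ht : t ≤ (k + 1) * δ)
    {b : ℕ → ℝ} (hb : ∀ j, 0 ≤ b j)
    (hfb : ∀ j ≤ k, ∀ s ∈ Icc (0 : ℝ) t, j * δ ≤ s → f (t - s) ≤ b j) :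
    ∫ s in Icc (0 : ℝ) t, f (t - s) ∂μ ≤ ε * ∑ j ∈ Finset.range (k + 1), b j := by
  set W : ℕ → Set ℝ := fun j => Icc (j * δ) (j * δ + δ)
  set g : ℕ → ℝ → ℝ := fun j => (W j).indicator fun _ => b j
  have hg0 (j s) : 0 ≤ g j s := indicator_nonneg (fun _ _ => hb j) s
  have hgi (j) : Integrable (g j) μ := (integrable_const _).indicator measurableSet_Icc
  have hGi : Integrable (fun s => ∑ j ∈ Finset.range (k + 1), g j s) μ :=
    integrable_finsetSum _ fun j _ => hgi j
  have hpt : ∀ s ∈ Icc (0 : ℝ) t, f (t - s) ≤ ∑ j ∈ Finset.range (k + 1), g j s := by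
    intro s hs
    obtain ⟨j, hjk, hj1, hj2⟩ : ∃ j ≤ k, j * δ ≤ s ∧ s ≤ j * δ + δ := by
      have h1 : (⌊s / δ⌋₊ : ℝ) * δ ≤ s :=
        (le_div_iff₀ hδ).1 (Nat.floor_le (div_nonneg hs.1 hδ.le))
      have h2 : s < (⌊s / δ⌋₊ + 1 : ℝ) * δ := (div_lt_iff₀ hδ).1 (Nat.lt_floor_add_one _)
      rcases le_or_gt ⌊s / δ⌋₊ k with h | h
      · exact ⟨_, h, h1, by linarith⟩
      · have h3 : (k : ℝ) + 1 ≤ ⌊s / δ⌋₊ := by exact_mod_cast h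
        exact ⟨k, le_rfl, by nlinarith, by linarith [hs.2]⟩
    calc f (t - s) ≤ b j := hfb j hjk s hs hj1
      _ = g j s := (indicator_of_mem (show s ∈ W j from ⟨hj1, hj2⟩) fun _ => b j).symm
      _ ≤ _ := Finset.single_le_sum (f := fun j => g j s) (fun i _ => hg0 i s)
        (Finset.mem_range.2 (Nat.lt_succ_of_le hjk))
  calc ∫ s in Icc (0 : ℝ) t, f (t - s) ∂μ
      ≤ ∫ s in Icc (0 : ℝ) t, ∑ j ∈ Finset.range (k + 1), g j s ∂μ :=
        setIntegral_mono_on (integrableOn_comp_sub_of_bounded μ hf hC) hGi.integrableOn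
          measurableSet_Icc hpt
    _ ≤ ∫ s, ∑ j ∈ Finset.range (k + 1), g j s ∂μ :=
        setIntegral_le_integral hGi (ae_of_all _ fun s => Finset.sum_nonneg fun j _ => hg0 j s)
    _ = ∑ j ∈ Finset.range (k + 1), (μ (W j)).toReal * b j := by
        rw [integral_finsetSum _ fun j _ => hgi j]
        refine Finset.sum_congr rfl fun j _ => ?_
        rw [integral_indicator_const _ measurableSet_Icc]
        rfl
    _ ≤ ε * ∑ j ∈ Finset.range (k + 1), b j := by
        rw [Finset.mul_sum]
        exact Finset.sum_le_sum fun j _ =>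
          mul_le_mul_of_nonneg_right (hμ _ (by positivity)) (hb j)

/-- A Grönwall-type inequality for the renewal inequality `f t ≤ X + ∫_{[0,t]} f (t - s) dμ(s)`. -/
lemma le_mul_pow_of_le_add_setIntegral (μ : Measure ℝ) [IsFiniteMeasure μ] {δ ε : ℝ}
    (hδ : 0 < δ) (hε : ε < 1) (hμ : ∀ y, 0 ≤ y → (μ (Icc y (y + δ))).toReal ≤ ε)
    {f : ℝ → ℝ} (hf : Measurable f) (hf0 : ∀ t, 0 ≤ f t) {T C X : ℝ} (hX : 0 ≤ X)
    (hC : ∀ t ∈ Icc (0 : ℝ) T, f t ≤ C)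
    (hren : ∀ t ∈ Icc (0 : ℝ) T, f t ≤ X + ∫ s in Icc (0 : ℝ) t, f (t - s) ∂μ) (k : ℕ) :
    ∀ t ∈ Icc (0 : ℝ) T, t ≤ (k + 1) * δ → f t ≤ X * (1 - ε)⁻¹ ^ (k + 1) := by
  induction k using Nat.strong_induction_on with
  | _ k ih =>
  intro t₀ ht₀ ht₀k
  have hε' : 0 < 1 - ε := by linarith
  set r := (1 - ε)⁻¹ with hr
  have hr0 : 0 ≤ r := inv_nonneg.2 hε'.le
  set S := f '' {t | t ∈ Icc (0 : ℝ) T ∧ t ≤ (k + 1) * δ}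
  set M := sSup S
  have hbdd : BddAbove S := ⟨C, by rintro _ ⟨t, ht, rfl⟩; exact hC t ht.1⟩
  have hfM : ∀ t ∈ Icc (0 : ℝ) T, t ≤ (k + 1) * δ → f t ≤ M := fun t h1 h2 =>
    le_csSup hbdd ⟨t, ⟨h1, h2⟩, rfl⟩
  have hM0 : 0 ≤ M := (hf0 _).trans (hfM t₀ ht₀ ht₀k)
  have hM : M ≤ X * r ^ k + ε * M := by
    refine csSup_le ⟨_, t₀, ⟨ht₀, ht₀k⟩, rfl⟩ ?_
    rintro _ ⟨t, ⟨ht, htk⟩, rfl⟩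
    have hint := setIntegral_comp_sub_le_sum μ hδ hμ hf
      (fun u hu => by rw [abs_of_nonneg (hf0 u)]; exact hC u ⟨hu.1, hu.2.trans ht.2⟩) htk
      (b := fun j => if j = 0 then M else X * r ^ (k + 1 - j))
      (fun j => by split_ifs <;> positivity) (fun j hj s hs hjs => by
        have hts : t - s ∈ Icc (0 : ℝ) T := ⟨by linarith [hs.2], by linarith [hs.1, ht.2]⟩
        split_ifs with h
        · exact hfM _ hts (by linarith [hs.1])
        · have hk : k - j + 1 = k + 1 - j := by omega
          rw [← hk]
          refine ih (k - j) (by omega) _ hts ?_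
          rw [Nat.cast_sub hj]
          linarith)
    rw [Finset.sum_range_succ'] at hint
    simp only [Nat.add_eq_zero_iff, one_ne_zero, and_false, if_false, if_true,
      Nat.add_sub_add_right] at hint
    rw [← Finset.mul_sum, mul_add, mul_left_comm, mul_sum_pow_inv_one_sub hε] at hint
    linarith [hren t ht]
  refine (hfM t₀ ht₀ ht₀k).trans ?_
  rw [pow_succ, ← mul_assoc, hr, ← div_eq_mul_inv, le_div_iff₀ hε']
  linarith

/-- Proposition 3.1 (Lipschitz continuity part): two solutions of the
convolution equation driven by `x₁` and `x₂` satisfy the Lipschitz bound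
`‖z₁ - z₂‖_T ≤ (1-ε)^{-⌈T/δ⌉} ‖x₁ - x₂‖_T`. -/
theorem stmt_2
    (μ : Measure ℝ) [IsProbabilityMeasure μ] (hμsupp : μ (Iio (0 : ℝ)) = 0)
    (a δ ε : ℝ) (hδ : 0 < δ) (hε0 : 0 < ε) (hε1 : ε < 1)
    (hμ : ∀ y, 0 ≤ y → (μ (Icc y (y + δ))).toReal ≤ ε)
    (x₁ x₂ z₁ z₂ : ℝ → ℝ)
    (hx₁m : Measurable x₁) (hx₂m : Measurable x₂)
    (hx₁b : ∀ T, 0 ≤ T → ∃ C, ∀ t ∈ Icc (0 : ℝ) T, |x₁ t| ≤ C)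
    (hx₂b : ∀ T, 0 ≤ T → ∃ C, ∀ t ∈ Icc (0 : ℝ) T, |x₂ t| ≤ C)
    (hz₁m : Measurable z₁) (hz₂m : Measurable z₂)
    (hz₁b : ∀ T, 0 ≤ T → ∃ C, ∀ t ∈ Icc (0 : ℝ) T, |z₁ t| ≤ C)
    (hz₂b : ∀ T, 0 ≤ T → ∃ C, ∀ t ∈ Icc (0 : ℝ) T, |z₂ t| ≤ C)
    (hz₁ : ∀ t, 0 ≤ t → z₁ t = x₁ t + ∫ s in Icc (0 : ℝ) t, max (z₁ (t - s) + a) 0 ∂μ)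
    (hz₂ : ∀ t, 0 ≤ t → z₂ t = x₂ t + ∫ s in Icc (0 : ℝ) t, max (z₂ (t - s) + a) 0 ∂μ)
    (T : ℝ) (hT : 0 < T) :
    sSup ((fun t => |z₁ t - z₂ t|) '' Icc (0 : ℝ) T) ≤
      (1 - ε) ^ (-⌈T / δ⌉) * sSup ((fun t => |x₁ t - x₂ t|) '' Icc (0 : ℝ) T) := by
  have hT0 : (0 : ℝ) ∈ Icc (0 : ℝ) T := ⟨le_rfl, hT.le⟩
  obtain ⟨C₁, hC₁⟩ := hz₁b T hT.le
  obtain ⟨C₂, hC₂⟩ := hz₂b T hT.le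
  obtain ⟨B₁, hB₁⟩ := hx₁b T hT.le
  obtain ⟨B₂, hB₂⟩ := hx₂b T hT.le
  set X := sSup ((fun t => |x₁ t - x₂ t|) '' Icc (0 : ℝ) T)
  have hxX : ∀ t ∈ Icc (0 : ℝ) T, |x₁ t - x₂ t| ≤ X := fun t ht => by
    refine le_csSup ⟨B₁ + B₂, ?_⟩ ⟨t, ht, rfl⟩
    rintro _ ⟨u, hu, rfl⟩
    exact (abs_sub _ _).trans (add_le_add (hB₁ u hu) (hB₂ u hu))
  have hzC : ∀ t ∈ Icc (0 : ℝ) T, |z₁ t - z₂ t| ≤ C₁ + C₂ := fun u hu =>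
    (abs_sub _ _).trans (add_le_add (hC₁ u hu) (hC₂ u hu))
  have hpos {z : ℝ → ℝ} {C : ℝ} (hz : Measurable z) (hC : ∀ t ∈ Icc (0 : ℝ) T, |z t| ≤ C)
      {t : ℝ} (ht : t ≤ T) :
      IntegrableOn (fun s => max (z (t - s) + a) 0) (Icc 0 t) μ :=
    integrableOn_comp_sub_of_bounded μ (f := fun u => max (z u + a) 0) (C := C + |a|)
      ((hz.add_const a).max measurable_const) fun u hu =>
        (abs_max_le_max_abs_abs.trans (by simp) : _ ≤ |z u + a|).trans
          ((abs_add_le _ _).trans (by gcongr; exact hC u ⟨hu.1, hu.2.trans ht⟩))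
  have hren : ∀ t ∈ Icc (0 : ℝ) T, |z₁ t - z₂ t| ≤
      X + ∫ s in Icc (0 : ℝ) t, |z₁ (t - s) - z₂ (t - s)| ∂μ := fun t ht => by
    have hi₁ := hpos hz₁m hC₁ ht.2
    have hi₂ := hpos hz₂m hC₂ ht.2
    have hi : IntegrableOn (fun s => |z₁ (t - s) - z₂ (t - s)|) (Icc 0 t) μ :=
      integrableOn_comp_sub_of_bounded μ (f := fun u => |z₁ u - z₂ u|)
        (hz₁m.sub hz₂m).abs (fun u hu => by
          rw [abs_abs]; exact hzC u ⟨hu.1, hu.2.trans ht.2⟩)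
    rw [hz₁ t ht.1, hz₂ t ht.1, add_sub_add_comm, ← integral_sub hi₁ hi₂]
    refine (abs_add_le _ _).trans (add_le_add (hxX t ht) ?_)
    refine abs_integral_le_integral_abs.trans (integral_mono (hi₁.sub hi₂).abs hi fun s => ?_)
    simpa using abs_max_sub_max_le_abs (z₁ (t - s) + a) (z₂ (t - s) + a) 0
  have hn : 0 < ⌈T / δ⌉ := Int.ceil_pos.2 (div_pos hT hδ)
  obtain ⟨k, hk⟩ : ∃ k : ℕ, ⌈T / δ⌉ = (k + 1 : ℕ) :=
    ⟨(⌈T / δ⌉ - 1).toNat, by omega⟩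
  have hTk : T ≤ (k + 1) * δ := by
    rw [← div_le_iff₀ hδ]
    have h := Int.le_ceil (T / δ)
    rw [hk] at h
    exact_mod_cast h
  rw [hk, zpow_neg, zpow_natCast, ← inv_pow, mul_comm]
  refine csSup_le ⟨_, 0, hT0, rfl⟩ ?_
  rintro _ ⟨t, ht, rfl⟩
  exact le_mul_pow_of_le_add_setIntegral μ hδ hε1 hμ (f := fun u => |z₁ u - z₂ u|)
    (hz₁m.sub hz₂m).abs (fun _ => abs_nonneg _) ((abs_nonneg _).trans (hxX 0 hT0)) hzC hren k
    t ht (ht.2.trans hTk)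
end

section
/- Let x₁, x₂ : [0,∞) → ℝ and let z₁, z₂ : [0,∞) → ℝ satisfy, for j = 1,2: z_j(t) = x_j(t) for 0 ≤ t < c and z_j(t) = x_j(t) + (z_j(t−c) + a)⁺ for t ≥ c. Then for every t ≥ 0, sup_{0 ≤ s ≤ t} |z₁(s) − z₂(s)| ≤ (⌊t/c⌋ + 1) · sup_{0 ≤ s ≤ t} |x₁(s) − x₂(s)|. -/
open Set

theorem abs_max_zero_sub_max_zero_le (u v a : ℝ) :
    |max (u + a) 0 - max (v + a) 0| ≤ |u - v| := by
  simpa using abs_max_sub_max_le_abs (u + a) (v + a) 0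

/-- Iterating the recursion over `n` delays bounds the difference of two solutions on
`[0, (n + 1) c)` by `n + 1` times a bound for the difference of the inputs. -/
theorem abs_sub_le_of_delay_recursion {c a : ℝ} (hc : 0 < c) {x₁ x₂ z₁ z₂ : ℝ → ℝ}
    (hz₁ : (∀ t, 0 ≤ t → t < c → z₁ t = x₁ t) ∧
      (∀ t, c ≤ t → z₁ t = x₁ t + max (z₁ (t - c) + a) 0))
    (hz₂ : (∀ t, 0 ≤ t → t < c → z₂ t = x₂ t) ∧
      (∀ t, c ≤ t → z₂ t = x₂ t + max (z₂ (t - c) + a) 0))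
    {t M : ℝ} (hM : ∀ s ∈ Icc (0 : ℝ) t, |x₁ s - x₂ s| ≤ M) (n : ℕ) :
    ∀ s ∈ Icc (0 : ℝ) t, s < (n + 1) * c → |z₁ s - z₂ s| ≤ (n + 1) * M := by
  induction n with
  | zero =>
    intro s hs hsc
    have hsc' : s < c := by simpa using hsc
    rw [hz₁.1 s hs.1 hsc', hz₂.1 s hs.1 hsc']
    simpa using hM s hs
  | succ n ih =>
    intro s hs hsc
    have hx := hM s hs
    push_cast at hsc ⊢
    rcases lt_or_ge s c with h | h
    · rw [hz₁.1 s hs.1 h, hz₂.1 s hs.1 h]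
      have hM0 : 0 ≤ M := (abs_nonneg _).trans hx
      have : 0 ≤ (n : ℝ) * M := by positivity
      linarith
    · have hprev := ih (s - c) ⟨by linarith, by linarith [hs.2]⟩ (by linarith)
      have hmax := abs_max_zero_sub_max_zero_le (z₁ (s - c)) (z₂ (s - c)) a
      rw [hz₁.2 s h, hz₂.2 s h, add_sub_add_comm]
      linarith [abs_add_le (x₁ s - x₂ s)
        (max (z₁ (s - c) + a) 0 - max (z₂ (s - c) + a) 0)]

/-- A bound for the difference of two solutions yields a bound for the difference of the inputs. -/
theorem abs_input_sub_le_of_delay_recursion {c a : ℝ} (hc : 0 < c) {x₁ x₂ z₁ z₂ : ℝ → ℝ}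
    (hz₁ : (∀ t, 0 ≤ t → t < c → z₁ t = x₁ t) ∧
      (∀ t, c ≤ t → z₁ t = x₁ t + max (z₁ (t - c) + a) 0))
    (hz₂ : (∀ t, 0 ≤ t → t < c → z₂ t = x₂ t) ∧
      (∀ t, c ≤ t → z₂ t = x₂ t + max (z₂ (t - c) + a) 0))
    {t K : ℝ} (hK : ∀ s ∈ Icc (0 : ℝ) t, |z₁ s - z₂ s| ≤ K) :
    ∀ s ∈ Icc (0 : ℝ) t, |x₁ s - x₂ s| ≤ 2 * K := by
  intro s hs
  have hz := hK s hs
  rcases lt_or_ge s c with h | h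
  · rw [← hz₁.1 s hs.1 h, ← hz₂.1 s hs.1 h]
    linarith [abs_nonneg (z₁ s - z₂ s)]
  · have hprev := hK (s - c) ⟨by linarith, by linarith [hs.2]⟩
    have hmax := abs_max_zero_sub_max_zero_le (z₁ (s - c)) (z₂ (s - c)) a
    have hx : x₁ s - x₂ s =
        (z₁ s - z₂ s) - (max (z₁ (s - c) + a) 0 - max (z₂ (s - c) + a) 0) := by
      rw [hz₁.2 s h, hz₂.2 s h]
      ring
    rw [hx]
    linarith [abs_sub (z₁ s - z₂ s) (max (z₁ (s - c) + a) 0 - max (z₂ (s - c) + a) 0)]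

/-- Proposition 3.1 (Lipschitz bound for a point mass at `c`): solutions of the
recursion `z t = x t` on `[0,c)`, `z t = x t + (z (t-c) + a)⁺` on `[c,∞)` satisfy
`‖z₁ - z₂‖_t ≤ (⌊t/c⌋ + 1) ‖x₁ - x₂‖_t`. -/
theorem stmt_4 (c a : ℝ) (hc : 0 < c)
    (x₁ x₂ z₁ z₂ : ℝ → ℝ)
    (hz₁ : (∀ t, 0 ≤ t → t < c → z₁ t = x₁ t) ∧
      (∀ t, c ≤ t → z₁ t = x₁ t + max (z₁ (t - c) + a) 0))
    (hz₂ : (∀ t, 0 ≤ t → t < c → z₂ t = x₂ t) ∧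
      (∀ t, c ≤ t → z₂ t = x₂ t + max (z₂ (t - c) + a) 0))
    (t : ℝ) (ht : 0 ≤ t) :
    sSup ((fun s => |z₁ s - z₂ s|) '' Icc (0 : ℝ) t) ≤
      ((⌊t / c⌋ : ℝ) + 1) * sSup ((fun s => |x₁ s - x₂ s|) '' Icc (0 : ℝ) t) := by
  by_cases hb : BddAbove ((fun s => |x₁ s - x₂ s|) '' Icc (0 : ℝ) t)
  · have hM : ∀ s ∈ Icc (0 : ℝ) t,
        |x₁ s - x₂ s| ≤ sSup ((fun s => |x₁ s - x₂ s|) '' Icc (0 : ℝ) t) :=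
      fun s hs => le_csSup hb (mem_image_of_mem _ hs)
    obtain ⟨n, hn⟩ := Int.eq_ofNat_of_zero_le (Int.floor_nonneg.2 (div_nonneg ht hc.le))
    have htn : t < ((n : ℝ) + 1) * c := by
      have := Int.lt_floor_add_one (t / c)
      rw [hn] at this
      exact (div_lt_iff₀ hc).1 (by simpa using this)
    rw [hn, Int.cast_natCast]
    refine csSup_le ((nonempty_Icc.2 ht).image _) ?_
    rintro _ ⟨s, hs, rfl⟩
    exact abs_sub_le_of_delay_recursion hc hz₁ hz₂ hM n s hs (hs.2.trans_lt htn)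
  · have hzb : ¬ BddAbove ((fun s => |z₁ s - z₂ s|) '' Icc (0 : ℝ) t) := by
      rintro ⟨K, hK⟩
      refine hb ⟨2 * K, ?_⟩
      rintro _ ⟨s, hs, rfl⟩
      exact abs_input_sub_le_of_delay_recursion hc hz₁ hz₂
        (fun s hs => hK (mem_image_of_mem _ hs)) s hs
    rw [Real.sSup_of_not_bddAbove hb, Real.sSup_of_not_bddAbove hzb, mul_zero]
end

section
/- Let x : [0,∞) → ℝ be Borel measurable and bounded on compact intervals, and define the successive approximations u₀ = 0 and u_{n+1}(t) = x(t) + ∫_{[0,t]} (u_n(t−s) + a)⁺ dμ(s) for t ≥ 0 and n ≥ 0. Then for every T > 0 of the form T = kδ with k a positive integer, every integer 1 ≤ j ≤ k and every n ≥ 1: sup_{0 ≤ t ≤ jδ} |u_{n+1}(t) − u_n(t)| ≤ j^j n^j ε^n sup_{0 ≤ t ≤ T} |x(t)|; in particular, for every T > 0, Σ_{n=1}^∞ sup_{0 ≤ t ≤ T} |u_{n+1}(t) − u_n(t)| < ∞. -/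
open MeasureTheory Set

/-- Real functions that are Borel measurable and locally bounded on `[0, ∞)`, with no condition on
the negative half-line. -/
structure MeasurableLocBddOnNonneg (v : ℝ → ℝ) : Prop where
  exists_measurable : ∃ w : ℝ → ℝ, Measurable w ∧ EqOn v w (Ici 0)
  exists_bound : ∀ T, 0 ≤ T → ∃ C, ∀ t ∈ Icc (0 : ℝ) T, |v t| ≤ C

namespace MeasurableLocBddOnNonneg

variable {μ : Measure ℝ} [IsProbabilityMeasure μ] {v v' : ℝ → ℝ}

lemma add (hv : MeasurableLocBddOnNonneg v) (hv' : MeasurableLocBddOnNonneg v') :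
    MeasurableLocBddOnNonneg (fun t => v t + v' t) := by
  obtain ⟨w, hw, hvw⟩ := hv.exists_measurable
  obtain ⟨w', hw', hvw'⟩ := hv'.exists_measurable
  refine ⟨⟨fun t => w t + w' t, hw.add hw', fun t ht => ?_⟩, fun T hT => ?_⟩
  · simp only [hvw ht, hvw' ht]
  · obtain ⟨C, hC⟩ := hv.exists_bound T hT
    obtain ⟨C', hC'⟩ := hv'.exists_bound T hT
    exact ⟨C + C', fun t ht => (abs_add_le _ _).trans (add_le_add (hC t ht) (hC' t ht))⟩

lemma const (c : ℝ) : MeasurableLocBddOnNonneg fun _ => c :=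
  ⟨⟨_, measurable_const, fun _ _ => rfl⟩, fun _ _ => ⟨|c|, fun _ _ => le_rfl⟩⟩

lemma congr (hv : MeasurableLocBddOnNonneg v) (h : EqOn v' v (Ici 0)) :
    MeasurableLocBddOnNonneg v' := by
  obtain ⟨w, hw, hvw⟩ := hv.exists_measurable
  refine ⟨⟨w, hw, h.trans hvw⟩, fun T hT => ?_⟩
  obtain ⟨C, hC⟩ := hv.exists_bound T hT
  exact ⟨C, fun t ht => by rw [h ht.1]; exact hC t ht⟩

lemma max_zero (hv : MeasurableLocBddOnNonneg v) :
    MeasurableLocBddOnNonneg (fun t => max (v t) 0) := by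
  obtain ⟨w, hw, hvw⟩ := hv.exists_measurable
  refine ⟨⟨fun t => max (w t) 0, hw.max measurable_const, fun t ht => ?_⟩, fun T hT => ?_⟩
  · simp only [hvw ht]
  · obtain ⟨C, hC⟩ := hv.exists_bound T hT
    refine ⟨C, fun t ht => le_trans ?_ (hC t ht)⟩
    simpa using abs_max_sub_max_le_abs (v t) 0 0

lemma integrableOn_comp_sub (hv : MeasurableLocBddOnNonneg v) {t : ℝ} (ht : 0 ≤ t) :
    IntegrableOn (fun s => v (t - s)) (Icc 0 t) μ := by
  obtain ⟨w, hw, hvw⟩ := hv.exists_measurable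
  obtain ⟨C, hC⟩ := hv.exists_bound t ht
  have hmeas : Measurable fun s => w (t - s) := hw.comp (measurable_const.sub measurable_id)
  have hint : IntegrableOn (fun s => w (t - s)) (Icc 0 t) μ := by
    refine Measure.integrableOn_of_bounded (M := C) (measure_ne_top _ _)
      hmeas.aestronglyMeasurable ?_
    refine (ae_restrict_iff' measurableSet_Icc).2 (.of_forall fun s hs => ?_)
    have h0 : 0 ≤ t - s := sub_nonneg.2 hs.2
    rw [← hvw (mem_Ici.2 h0)]
    exact hC _ ⟨h0, sub_le_self _ hs.1⟩
  exact hint.congr_fun (fun s hs => (hvw (mem_Ici.2 (sub_nonneg.2 hs.2))).symm)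
    measurableSet_Icc

lemma convolution (hv : MeasurableLocBddOnNonneg v) :
    MeasurableLocBddOnNonneg (fun t => ∫ s in Icc (0 : ℝ) t, v (t - s) ∂μ) := by
  constructor
  · obtain ⟨w, hw, hvw⟩ := hv.exists_measurable
    refine ⟨fun t => ∫ s, {p : ℝ × ℝ | 0 ≤ p.2 ∧ p.2 ≤ p.1}.indicator
      (fun p => w (p.1 - p.2)) (t, s) ∂μ, ?_, fun t _ => ?_⟩
    · have hs : MeasurableSet {p : ℝ × ℝ | 0 ≤ p.2 ∧ p.2 ≤ p.1} :=
        (measurableSet_le measurable_const measurable_snd).inter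
          (measurableSet_le measurable_snd measurable_fst)
      have hm : Measurable fun p : ℝ × ℝ => w (p.1 - p.2) :=
        hw.comp (measurable_fst.sub measurable_snd)
      exact (hm.indicator hs).stronglyMeasurable.integral_prod_right'.measurable
    · simp only
      rw [← integral_indicator measurableSet_Icc]
      congr 1 with s
      by_cases hs : s ∈ Icc 0 t
      · rw [indicator_of_mem hs, indicator_of_mem (by exact hs),
          hvw (mem_Ici.2 (sub_nonneg.2 hs.2))]
      · rw [indicator_of_notMem hs, indicator_of_notMem (by exact hs)]
  · intro T hT
    obtain ⟨C, hC⟩ := hv.exists_bound T hT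
    have hC0 : 0 ≤ C := (abs_nonneg _).trans (hC 0 ⟨le_rfl, hT⟩)
    refine ⟨C, fun t ht => ?_⟩
    have h := norm_setIntegral_le_of_norm_le_const (μ := μ) (s := Icc 0 t) (C := C)
      (f := fun s => v (t - s)) (measure_lt_top _ _)
      (fun s hs => hC _ ⟨sub_nonneg.2 hs.2, by linarith [hs.1, ht.2]⟩)
    exact h.trans (mul_le_of_le_one_right hC0 measureReal_le_one)

/-- Splitting `[0, t]` into blocks of length `δ`, each of `μ`-mass at most `ε`, bounds a convolution
by a sum of bounds over the blocks. -/
lemma convolution_le_sum_blocks {δ ε : ℝ} (hδ : 0 < δ)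
    (hμ : ∀ y, 0 ≤ y → (μ (Icc y (y + δ))).toReal ≤ ε) {g : ℝ → ℝ} {B : ℕ → ℝ} {m : ℕ}
    (hB0 : ∀ i, 0 ≤ B i) (hB : ∀ i ≤ m, ∀ r ∈ Icc (0 : ℝ) ((i + 1 : ℝ) * δ), g r ≤ B i)
    {t : ℝ} (ht : t ∈ Icc (0 : ℝ) ((m + 1 : ℝ) * δ))
    (hg : IntegrableOn (fun s => g (t - s)) (Icc 0 t) μ) :
    ∫ s in Icc (0 : ℝ) t, g (t - s) ∂μ ≤ ε * ∑ i ∈ Finset.range (m + 1), B i := by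
  have hind (i : ℕ) : Integrable
      ((Icc (i * δ) (i * δ + δ)).indicator fun _ => B (m - i)) μ :=
    (integrable_const _).indicator measurableSet_Icc
  calc ∫ s in Icc (0 : ℝ) t, g (t - s) ∂μ
      = ∫ s, (Icc 0 t).indicator (fun s => g (t - s)) s ∂μ :=
        (integral_indicator measurableSet_Icc).symm
    _ ≤ ∫ s, ∑ i ∈ Finset.range (m + 1),
          (Icc (i * δ) (i * δ + δ)).indicator (fun _ => B (m - i)) s ∂μ := by
        refine integral_mono (hg.integrable_indicator measurableSet_Icc)
          (integrable_finsetSum _ fun i _ => hind i) fun s => ?_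
        have hnn : ∀ i ∈ Finset.range (m + 1),
            0 ≤ (Icc (i * δ) (i * δ + δ)).indicator (fun _ => B (m - i)) s :=
          fun i _ => indicator_nonneg (fun _ _ => hB0 _) _
        by_cases hs : s ∈ Icc 0 t
        · simp only [indicator_of_mem hs]
          have hfl : ((min ⌊s / δ⌋₊ m : ℕ) : ℝ) * δ ≤ s := by
            rw [← le_div_iff₀ hδ]
            exact (Nat.cast_le.2 (min_le_left _ _)).trans (Nat.floor_le (div_nonneg hs.1 hδ.le))
          have hfu : s ≤ ((min ⌊s / δ⌋₊ m : ℕ) : ℝ) * δ + δ := by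
            rcases min_choice ⌊s / δ⌋₊ m with h | h <;> rw [h]
            · have := (div_lt_iff₀ hδ).1 (Nat.lt_floor_add_one (s / δ))
              linarith
            · linarith [hs.2, ht.2]
          have him : min ⌊s / δ⌋₊ m ≤ m := min_le_right _ _
          generalize min ⌊s / δ⌋₊ m = i at hfl hfu him
          refine le_trans ?_ (Finset.single_le_sum hnn (Finset.mem_range.2 (Nat.lt_succ_of_le him)))
          rw [indicator_of_mem (mem_Icc.2 ⟨hfl, hfu⟩)]
          refine hB _ (Nat.sub_le _ _) _ ⟨sub_nonneg.2 hs.2, ?_⟩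
          rw [Nat.cast_sub him]
          linarith [ht.2]
        · simp only [indicator_of_notMem hs]
          exact Finset.sum_nonneg hnn
    _ = ∑ i ∈ Finset.range (m + 1), μ.real (Icc (i * δ) (i * δ + δ)) * B (m - i) := by
        rw [integral_finsetSum _ fun i _ => hind i]
        simp [integral_indicator_const, measurableSet_Icc]
    _ ≤ ∑ i ∈ Finset.range (m + 1), ε * B (m - i) :=
        Finset.sum_le_sum fun i _ =>
          mul_le_mul_of_nonneg_right (hμ _ (by positivity)) (hB0 _)
    _ = ε * ∑ i ∈ Finset.range (m + 1), B i := by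
        rw [← Finset.mul_sum, ← Finset.sum_range_reflect B (m + 1)]
        simp

end MeasurableLocBddOnNonneg

open MeasurableLocBddOnNonneg in
/-- Increments of the successive approximations, with the sharp binomial constant. -/
lemma abs_successiveApprox_sub_le
    {μ : Measure ℝ} [IsProbabilityMeasure μ] {a δ ε : ℝ} (ha : a ≤ 0) (hδ : 0 < δ) (hε0 : 0 < ε)
    (hμ : ∀ y, 0 ≤ y → (μ (Icc y (y + δ))).toReal ≤ ε)
    {x : ℝ → ℝ} {u : ℕ → ℝ → ℝ}
    (hu0 : ∀ t, 0 ≤ t → u 0 t = 0)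
    (hu : ∀ n : ℕ, ∀ t, 0 ≤ t →
      u (n + 1) t = x t + ∫ s in Icc (0 : ℝ) t, max (u n (t - s) + a) 0 ∂μ)
    (hreg : ∀ n, MeasurableLocBddOnNonneg (u n)) {C : ℝ} (hC0 : 0 ≤ C) (n : ℕ) :
    ∀ m : ℕ, (∀ t ∈ Icc (0 : ℝ) ((m + 1 : ℝ) * δ), |x t| ≤ C) →
      ∀ t ∈ Icc (0 : ℝ) ((m + 1 : ℝ) * δ),
        |u (n + 1) t - u n t| ≤ ((m + n).choose n : ℝ) * ε ^ n * C := by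
  induction n with
  | zero =>
    intro m hx t ht
    have h : ∫ s in Icc (0 : ℝ) t, max (u 0 (t - s) + a) 0 ∂μ = 0 := by
      refine setIntegral_eq_zero_of_forall_eq_zero fun s hs => ?_
      rw [hu0 _ (sub_nonneg.2 hs.2), zero_add, max_eq_right ha]
    rw [hu 0 t ht.1, h, hu0 t ht.1]
    simpa using hx t ht
  | succ n ih =>
    intro m hx t ht
    have hint (k : ℕ) : IntegrableOn (fun s => max (u k (t - s) + a) 0) (Icc 0 t) μ :=
      ((hreg k).add (const a)).max_zero.integrableOn_comp_sub ht.1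
    have hsub : IntegrableOn (fun s => |u (n + 1) (t - s) - u n (t - s)|) (Icc 0 t) μ :=
      (((hreg (n + 1)).integrableOn_comp_sub ht.1).sub
        ((hreg n).integrableOn_comp_sub ht.1)).abs
    calc |u (n + 1 + 1) t - u (n + 1) t|
        = |∫ s in Icc (0 : ℝ) t,
            (max (u (n + 1) (t - s) + a) 0 - max (u n (t - s) + a) 0) ∂μ| := by
          rw [integral_sub (hint (n + 1)) (hint n), hu (n + 1) t ht.1, hu n t ht.1,
            add_sub_add_left_eq_sub]
      _ ≤ ∫ s in Icc (0 : ℝ) t, |max (u (n + 1) (t - s) + a) 0 - max (u n (t - s) + a) 0| ∂μ :=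
          abs_integral_le_integral_abs
      _ ≤ ∫ s in Icc (0 : ℝ) t, |u (n + 1) (t - s) - u n (t - s)| ∂μ := by
          refine integral_mono ((hint (n + 1)).sub (hint n)).abs hsub fun s => ?_
          simpa using abs_max_sub_max_le_abs (u (n + 1) (t - s) + a) (u n (t - s) + a) 0
      _ ≤ ε * ∑ i ∈ Finset.range (m + 1), ((i + n).choose n : ℝ) * ε ^ n * C := by
          refine convolution_le_sum_blocks (g := fun r => |u (n + 1) r - u n r|) hδ hμ
            (fun i => by positivity) (fun i him => ih i fun r hr => hx r ⟨hr.1, hr.2.trans ?_⟩)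
            ht hsub
          gcongr
      _ = ((m + (n + 1)).choose (n + 1) : ℝ) * ε ^ (n + 1) * C := by
          rw [← add_assoc, ← Nat.sum_range_add_choose, Nat.cast_sum, ← Finset.sum_mul,
            ← Finset.sum_mul]
          ring

lemma choose_add_le_pow_mul_pow {j n : ℕ} (hj : 1 ≤ j) (hn : 1 ≤ n) :
    (j - 1 + n).choose n ≤ j ^ j * n ^ j := by
  obtain ⟨m, rfl⟩ := Nat.exists_eq_add_of_le' hj
  obtain ⟨l, rfl⟩ := Nat.exists_eq_add_of_le' hn
  rw [Nat.add_sub_cancel, ← mul_pow, ← Nat.choose_symm_add]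
  calc (m + (l + 1)).choose m ≤ (m + (l + 1)) ^ m := Nat.choose_le_pow _ _
    _ ≤ ((m + 1) * (l + 1)) ^ m := Nat.pow_le_pow_left (by nlinarith [Nat.zero_le (m * l)]) _
    _ ≤ ((m + 1) * (l + 1)) ^ (m + 1) := Nat.pow_le_pow_right (by positivity) (Nat.le_succ m)

/-- The successive-approximations estimate from the existence part of the proof of
Proposition 3.1: with `u₀ = 0` and
`u_{n+1}(t) = x(t) + ∫_{[0,t]} (u_n(t-s)+a)⁺ dμ(s)`, for `T = kδ`, `1 ≤ j ≤ k` and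
`n ≥ 1` one has `‖u_{n+1} - u_n‖_{jδ} ≤ j^j n^j ε^n ‖x‖_T`; in particular the series
`Σ_n ‖u_{n+1} - u_n‖_T` converges for every `T > 0`. -/
theorem stmt_5
    (μ : Measure ℝ) [IsProbabilityMeasure μ] (hμsupp : μ (Iio (0 : ℝ)) = 0)
    (a : ℝ) (ha : a ≤ 0)
    (δ ε : ℝ) (hδ : 0 < δ) (hε0 : 0 < ε) (hε1 : ε < 1)
    (hμ : ∀ y, 0 ≤ y → (μ (Icc y (y + δ))).toReal ≤ ε)
    (x : ℝ → ℝ) (hxm : Measurable x)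
    (hxb : ∀ T, 0 ≤ T → ∃ C, ∀ t ∈ Icc (0 : ℝ) T, |x t| ≤ C)
    (u : ℕ → ℝ → ℝ)
    (hu0 : ∀ t, 0 ≤ t → u 0 t = 0)
    (hu : ∀ n : ℕ, ∀ t, 0 ≤ t →
      u (n + 1) t = x t + ∫ s in Icc (0 : ℝ) t, max (u n (t - s) + a) 0 ∂μ) :
    (∀ k : ℕ, 1 ≤ k → ∀ j : ℕ, 1 ≤ j → j ≤ k → ∀ n : ℕ, 1 ≤ n →
      sSup ((fun t => |u (n + 1) t - u n t|) '' Icc (0 : ℝ) ((j : ℝ) * δ)) ≤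
        (j : ℝ) ^ j * (n : ℝ) ^ j * ε ^ n *
          sSup ((fun t => |x t|) '' Icc (0 : ℝ) ((k : ℝ) * δ))) ∧
    (∀ T : ℝ, 0 < T →
      Summable (fun n : ℕ => sSup ((fun t => |u (n + 1) t - u n t|) '' Icc (0 : ℝ) T))) := by
  have hreg (n : ℕ) : MeasurableLocBddOnNonneg (u n) := by
    induction n with
    | zero => exact (MeasurableLocBddOnNonneg.const 0).congr fun t ht => hu0 t ht
    | succ n ih =>
      have hx : MeasurableLocBddOnNonneg x := ⟨⟨x, hxm, fun _ _ => rfl⟩, hxb⟩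
      exact (hx.add ((ih.add (.const a)).max_zero.convolution (μ := μ))).congr
        fun t ht => hu n t ht
  refine ⟨fun k hk j hj hjk n hn => ?_, fun T hT => ?_⟩
  · obtain ⟨C, hC⟩ := hxb (k * δ) (by positivity)
    have hbdd : BddAbove ((fun t => |x t|) '' Icc (0 : ℝ) ((k : ℝ) * δ)) :=
      ⟨C, forall_mem_image.2 hC⟩
    have hN0 : 0 ≤ sSup ((fun t => |x t|) '' Icc (0 : ℝ) ((k : ℝ) * δ)) :=
      Real.sSup_nonneg (forall_mem_image.2 fun t _ => abs_nonneg _)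
    have hj' : ((j - 1 : ℕ) + 1 : ℝ) = j := by exact_mod_cast Nat.sub_add_cancel hj
    have hle : (j : ℝ) * δ ≤ k * δ := by gcongr
    refine Real.sSup_le (forall_mem_image.2 fun t ht => ?_) (by positivity)
    refine (abs_successiveApprox_sub_le ha hδ hε0 hμ hu0 hu hreg hN0 n (j - 1)
      (fun r hr => le_csSup hbdd (mem_image_of_mem _ ?_)) t (by rwa [hj'])).trans ?_
    · rw [hj'] at hr
      exact ⟨hr.1, hr.2.trans hle⟩
    · gcongr
      exact_mod_cast choose_add_le_pow_mul_pow hj hn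
  · obtain ⟨m, hm⟩ := exists_nat_ge (T / δ)
    have hTm : T ≤ (m + 1 : ℝ) * δ := by
      have := (div_le_iff₀ hδ).1 hm
      linarith
    obtain ⟨C, hC⟩ := hxb ((m + 1) * δ) (by positivity)
    have hC0 : 0 ≤ C := (abs_nonneg _).trans (hC 0 ⟨le_rfl, by positivity⟩)
    have hsum : Summable fun n : ℕ => ((n + m).choose m : ℝ) * ε ^ n * C :=
      (summable_choose_mul_geometric_of_norm_lt_one m
        (by rwa [Real.norm_of_nonneg hε0.le])).mul_right C
    refine hsum.of_nonneg_of_le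
      (fun n => Real.sSup_nonneg (forall_mem_image.2 fun t _ => abs_nonneg _)) fun n => ?_
    refine Real.sSup_le (forall_mem_image.2 fun t ht => ?_) (by positivity)
    have h := abs_successiveApprox_sub_le ha hδ hε0 hμ hu0 hu hreg hC0 n m hC t
      ⟨ht.1, ht.2.trans hTm⟩
    rwa [← Nat.choose_symm_add, add_comm m n] at h
end

section
/- The constant function z ≡ 1 is the unique Borel measurable function z : [0,∞) → ℝ, bounded on compact intervals, satisfying z(t) = (1 − F_e(t)) + ∫_0^t G(s) ds + ∫_{[0,t]} (z(t−s) − 1)⁺ dμ(s) for all t ≥ 0. -/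
open MeasureTheory Set

/-- If `w` vanishes on `[0, r)` and `w ≤ K` on `[0, r + δ)`, then the convolution of the positive
part of `w` with `μ` is at most `μ [0, δ] * K` on `[0, r + δ)`. -/
lemma setIntegral_posPart_convolution_le (μ : Measure ℝ) [IsFiniteMeasure μ] {w : ℝ → ℝ}
    {δ r K : ℝ} (hK : 0 ≤ K) (h0 : ∀ t, 0 ≤ t → t < r → w t = 0)
    (hw : ∀ t, 0 ≤ t → t < r + δ → w t ≤ K) {t : ℝ} (ht : t < r + δ) :
    ∫ s in Icc (0 : ℝ) t, max (w (t - s)) 0 ∂μ ≤ (μ (Icc 0 δ)).toReal * K := by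
  have hint : Integrable ((Icc (0 : ℝ) δ).indicator fun _ => K) μ :=
    (integrable_const K).indicator measurableSet_Icc
  have hnonneg : ∀ s, 0 ≤ (Icc (0 : ℝ) δ).indicator (fun _ => K) s :=
    fun s => indicator_nonneg (fun _ _ => hK) s
  calc ∫ s in Icc (0 : ℝ) t, max (w (t - s)) 0 ∂μ
      ≤ ∫ s in Icc (0 : ℝ) t, (Icc (0 : ℝ) δ).indicator (fun _ => K) s ∂μ := by
        refine integral_mono_of_nonneg (ae_of_all _ fun s => le_max_right _ _)
          hint.integrableOn ?_
        filter_upwards [ae_restrict_mem measurableSet_Icc] with s hs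
        have hts : 0 ≤ t - s := sub_nonneg.2 hs.2
        by_cases hsδ : s ≤ δ
        · rw [indicator_of_mem (show s ∈ Icc (0 : ℝ) δ from ⟨hs.1, hsδ⟩)]
          exact max_le (hw _ hts (by linarith [hs.1])) hK
        · rw [h0 _ hts (by linarith), max_self]
          exact hnonneg s
    _ ≤ ∫ s, (Icc (0 : ℝ) δ).indicator (fun _ => K) s ∂μ :=
        setIntegral_le_integral hint (ae_of_all _ hnonneg)
    _ = (μ (Icc 0 δ)).toReal * K := by
        rw [integral_indicator measurableSet_Icc, setIntegral_const, smul_eq_mul, measureReal_def]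

/-- A function, bounded above on compact intervals, that equals the convolution of its positive
part with `μ` vanishes on `[0, ∞)` if `μ [0, δ] < 1` for some `δ > 0`. -/
lemma eq_zero_of_eq_posPart_convolution (μ : Measure ℝ) [IsFiniteMeasure μ] {w : ℝ → ℝ}
    {δ ε : ℝ} (hδ : 0 < δ) (hε0 : 0 ≤ ε) (hε1 : ε < 1) (hμ : (μ (Icc 0 δ)).toReal ≤ ε)
    (hb : ∀ T, 0 ≤ T → ∃ C, ∀ t ∈ Icc (0 : ℝ) T, w t ≤ C)
    (hw : ∀ t, 0 ≤ t → w t = ∫ s in Icc (0 : ℝ) t, max (w (t - s)) 0 ∂μ) :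
    ∀ t, 0 ≤ t → w t = 0 := by
  have hnonneg : ∀ t, 0 ≤ t → 0 ≤ w t := fun t ht => by
    rw [hw t ht]
    exact integral_nonneg fun s => le_max_right _ _
  have key : ∀ n : ℕ, ∀ t, 0 ≤ t → t < n * δ → w t = 0 := by
    intro n
    induction n with
    | zero => intro t h1 h2; norm_num at h2; linarith
    | succ n ih =>
      have hsucc : ((n + 1 : ℕ) : ℝ) * δ = n * δ + δ := by push_cast; ring
      rw [hsucc]
      obtain ⟨C, hC⟩ := hb (n * δ + δ) (by positivity)
      have hC0 : 0 ≤ C := (hnonneg 0 le_rfl).trans (hC 0 ⟨le_rfl, by positivity⟩)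
      have hpow : ∀ k : ℕ, ∀ t, 0 ≤ t → t < n * δ + δ → w t ≤ ε ^ k * C := by
        intro k
        induction k with
        | zero => intro t h1 h2; simpa using hC t ⟨h1, h2.le⟩
        | succ k ihk =>
          intro t h1 h2
          have hK : 0 ≤ ε ^ k * C := by positivity
          calc w t ≤ (μ (Icc 0 δ)).toReal * (ε ^ k * C) :=
                (hw t h1).trans_le (setIntegral_posPart_convolution_le μ hK ih ihk h2)
            _ ≤ ε * (ε ^ k * C) := mul_le_mul_of_nonneg_right hμ hK
            _ = ε ^ (k + 1) * C := by ring
      intro t h1 h2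
      have hlim := (tendsto_pow_atTop_nhds_zero_of_lt_one hε0 hε1).mul_const C
      rw [zero_mul] at hlim
      exact le_antisymm (ge_of_tendsto' hlim fun k => hpow k t h1 h2) (hnonneg t h1)
  intro t ht
  obtain ⟨n, hn⟩ := exists_nat_gt (t / δ)
  exact key n t ht ((div_lt_iff₀ hδ).1 hn)

/-- Corollary 5.1: the constant function `1` is the unique Borel measurable function,
bounded on compact intervals, satisfying
`z(t) = (1 - F_e(t)) + ∫_0^t G(s) ds + ∫_{[0,t]} (z(t-s) - 1)⁺ dμ(s)` for all `t ≥ 0`. -/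
theorem stmt_6
    (μ : Measure ℝ) [IsProbabilityMeasure μ] (hμsupp : μ (Iio (0 : ℝ)) = 0)
    (δ ε : ℝ) (hδ : 0 < δ) (hε0 : 0 < ε) (hε1 : ε < 1)
    (hμ : ∀ y, 0 ≤ y → (μ (Icc y (y + δ))).toReal ≤ ε)
    (F G Fe : ℝ → ℝ)
    (hF : ∀ t, F t = (μ (Icc (0 : ℝ) t)).toReal)
    (hG : ∀ t, G t = 1 - F t)
    (hFe : ∀ t, Fe t = ∫ u in (0 : ℝ)..t, G u) :
    ((Measurable (fun _ : ℝ => (1 : ℝ)) ∧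
        (∀ T, 0 ≤ T → ∃ C, ∀ t ∈ Icc (0 : ℝ) T, |(1 : ℝ)| ≤ C) ∧
        (∀ t, 0 ≤ t → (1 : ℝ) = (1 - Fe t) + (∫ s in (0 : ℝ)..t, G s) +
          ∫ s in Icc (0 : ℝ) t, max ((1 : ℝ) - 1) 0 ∂μ)) ∧
      ∀ z : ℝ → ℝ, Measurable z →
        (∀ T, 0 ≤ T → ∃ C, ∀ t ∈ Icc (0 : ℝ) T, |z t| ≤ C) →
        (∀ t, 0 ≤ t → z t = (1 - Fe t) + (∫ s in (0 : ℝ)..t, G s) +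
          ∫ s in Icc (0 : ℝ) t, max (z (t - s) - 1) 0 ∂μ) →
        ∀ t, 0 ≤ t → z t = 1) := by
  refine ⟨⟨measurable_const, fun T _ => ⟨1, fun t _ => by simp⟩, fun t _ => ?_⟩, ?_⟩
  · simp [hFe]
  · intro z _ hzb hz t ht
    refine sub_eq_zero.1 (eq_zero_of_eq_posPart_convolution μ (w := fun t => z t - 1) hδ hε0.le hε1
      (by simpa using hμ 0 le_rfl) (fun T hT => ?_) (fun t ht => ?_) t ht)
    · obtain ⟨C, hC⟩ := hzb T hT
      exact ⟨C, fun t ht => by linarith [le_abs_self (z t), hC t ht]⟩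
    · have h := hz t ht
      rw [hFe] at h
      linarith
end

section
/- For every t ≥ 0, F_e(t) + ∫_{[0,t]} F_e(t−s) dν(s) = t. -/
open MeasureTheory Set

/-- Convolution of two Borel measures on `ℝ` (pushforward of the product under addition). -/
noncomputable def convMeas (μ ν : Measure ℝ) : Measure ℝ :=
  Measure.map (fun p : ℝ × ℝ => p.1 + p.2) (μ.prod ν)

/-- `n`-fold convolution power of a measure on `ℝ` (the `0`-th power is `δ₀`). -/
noncomputable def convPow (μ : Measure ℝ) : ℕ → Measure ℝ
  | 0 => Measure.dirac 0
  | n + 1 => convMeas (convPow μ n) μ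

/-- The renewal measure `ν = Σ_{n≥1} μ^{*n}`. -/
noncomputable def renewalMeasure (μ : Measure ℝ) : Measure ℝ :=
  Measure.sum (fun n : ℕ => convPow μ (n + 1))

open scoped ENNReal
open Filter Topology

theorem isProbabilityMeasure_convPow (μ : Measure ℝ) [IsProbabilityMeasure μ] (n : ℕ) :
    IsProbabilityMeasure (convPow μ n) := by
  induction n with
  | zero => exact Measure.dirac.isProbabilityMeasure
  | succ n ih => exact Measure.isProbabilityMeasure_map (by fun_prop)

theorem lintegral_convPow_succ (μ : Measure ℝ) [IsProbabilityMeasure μ] (n : ℕ)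
    {f : ℝ → ℝ≥0∞} (hf : Measurable f) :
    ∫⁻ z, f z ∂(convPow μ (n + 1)) = ∫⁻ x, ∫⁻ y, f (x + y) ∂μ ∂(convPow μ n) := by
  rw [convPow, convMeas, lintegral_map hf (by fun_prop), lintegral_prod _ (by fun_prop)]

theorem ae_nonneg_convPow (μ : Measure ℝ) [IsProbabilityMeasure μ] (hμ : ∀ᵐ x ∂μ, 0 ≤ x) (n : ℕ) :
    ∀ᵐ x ∂(convPow μ n), 0 ≤ x := by
  have := isProbabilityMeasure_convPow μ
  induction n with
  | zero => exact (ae_dirac_iff measurableSet_Ici).2 le_rfl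
  | succ n ih =>
    refine (ae_map_iff (by fun_prop) measurableSet_Ici).2 ?_
    filter_upwards [Measure.quasiMeasurePreserving_fst.ae ih,
      Measure.quasiMeasurePreserving_snd.ae hμ] with p h₁ h₂ using add_nonneg h₁ h₂

/-- The truncated mean `s ↦ ∫ min s y dμ(y)`, which for `s ≥ 0` is the equilibrium distribution
function of `μ`. -/
noncomputable def truncMean (μ : Measure ℝ) (s : ℝ) : ℝ≥0∞ :=
  ∫⁻ y, ENNReal.ofReal (min s y) ∂μ

@[fun_prop]
theorem measurable_truncMean (μ : Measure ℝ) [SFinite μ] : Measurable (truncMean μ) :=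
  Measurable.lintegral_prod_right' (f := fun p : ℝ × ℝ => ENNReal.ofReal (min p.1 p.2))
    (by fun_prop)

theorem truncMean_le (μ : Measure ℝ) [IsProbabilityMeasure μ] (s : ℝ) :
    truncMean μ s ≤ ENNReal.ofReal s := by
  calc truncMean μ s ≤ ∫⁻ _, ENNReal.ofReal s ∂μ :=
        lintegral_mono fun y => ENNReal.ofReal_le_ofReal (min_le_left _ _)
    _ = ENNReal.ofReal s := by simp

theorem ofReal_eq_ofReal_min_add (s : ℝ) {y : ℝ} (hy : 0 ≤ y) :
    ENNReal.ofReal s = ENNReal.ofReal (min s y) + ENNReal.ofReal (s - y) := by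
  rcases le_total s y with h | h
  · rw [min_eq_left h, ENNReal.ofReal_of_nonpos (sub_nonpos.2 h), add_zero]
  · rw [min_eq_right h, ← ENNReal.ofReal_add hy (sub_nonneg.2 h), add_sub_cancel]

theorem ofReal_eq_truncMean_add (μ : Measure ℝ) [IsProbabilityMeasure μ] (hμ : ∀ᵐ x ∂μ, 0 ≤ x)
    (s : ℝ) : ENNReal.ofReal s = truncMean μ s + ∫⁻ y, ENNReal.ofReal (s - y) ∂μ := by
  rw [truncMean, ← lintegral_add_left (by fun_prop)]
  calc ENNReal.ofReal s = ∫⁻ _, ENNReal.ofReal s ∂μ := by simp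
    _ = _ := lintegral_congr_ae (hμ.mono fun y hy => ofReal_eq_ofReal_min_add s hy)

theorem sum_lintegral_truncMean_add (μ : Measure ℝ) [IsProbabilityMeasure μ]
    (hμ : ∀ᵐ x ∂μ, 0 ≤ x) (t : ℝ) (N : ℕ) :
    ∑ n ∈ Finset.range N, ∫⁻ x, truncMean μ (t - x) ∂(convPow μ n)
      + ∫⁻ x, ENNReal.ofReal (t - x) ∂(convPow μ N) = ENNReal.ofReal t := by
  induction N with
  | zero => simp [convPow]
  | succ N ih =>
    rw [Finset.sum_range_succ, lintegral_convPow_succ μ N (by fun_prop), add_assoc,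
      ← lintegral_add_left (by fun_prop), ← ih]
    simp_rw [← sub_sub, ← ofReal_eq_truncMean_add μ hμ]

theorem tsum_lintegral_truncMean (μ : Measure ℝ) [IsProbabilityMeasure μ]
    (hμ : ∀ᵐ x ∂μ, 0 ≤ x) (t : ℝ) (hfin : renewalMeasure μ (Icc 0 t) < ⊤) :
    ∑' n, ∫⁻ x, truncMean μ (t - x) ∂(convPow μ n) = ENNReal.ofReal t := by
  have hP : Tendsto (fun n => convPow μ n (Icc 0 t)) atTop (𝓝 0) := by
    rw [renewalMeasure, Measure.sum_apply _ measurableSet_Icc] at hfin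
    exact (tendsto_add_atTop_iff_nat 1).1 (ENNReal.tendsto_atTop_zero_of_tsum_ne_top hfin.ne)
  have hrem : Tendsto (fun n => ∫⁻ x, ENNReal.ofReal (t - x) ∂(convPow μ n)) atTop (𝓝 0) := by
    have hlim : Tendsto (fun n => ENNReal.ofReal t * convPow μ n (Icc 0 t)) atTop (𝓝 0) := by
      simpa using ENNReal.Tendsto.const_mul hP (Or.inr ENNReal.ofReal_ne_top)
    refine tendsto_of_tendsto_of_tendsto_of_le_of_le tendsto_const_nhds hlim
      (fun _ => zero_le) fun n => ?_
    rw [← lintegral_indicator_const measurableSet_Icc]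
    refine lintegral_mono_ae ((ae_nonneg_convPow μ hμ n).mono fun x hx => ?_)
    by_cases hxt : x ≤ t
    · rw [indicator_of_mem (mem_Icc.2 ⟨hx, hxt⟩)]
      exact ENNReal.ofReal_le_ofReal (by linarith)
    · rw [ENNReal.ofReal_of_nonpos (by linarith)]
      exact zero_le
  have h := (ENNReal.tendsto_nat_tsum
    fun n => ∫⁻ x, truncMean μ (t - x) ∂(convPow μ n)).add hrem
  simp_rw [sum_lintegral_truncMean_add μ hμ t, add_zero] at h
  exact tendsto_nhds_unique h tendsto_const_nhds

theorem truncMean_add_lintegral_renewalMeasure (μ : Measure ℝ) [IsProbabilityMeasure μ]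
    (hμ : ∀ᵐ x ∂μ, 0 ≤ x) (t : ℝ) (hfin : renewalMeasure μ (Icc 0 t) < ⊤) :
    truncMean μ t + ∫⁻ x in Icc 0 t, truncMean μ (t - x) ∂(renewalMeasure μ)
      = ENNReal.ofReal t := by
  have hν : ∀ᵐ x ∂(renewalMeasure μ), 0 ≤ x :=
    Measure.ae_sum_iff.2 fun n => ae_nonneg_convPow μ hμ (n + 1)
  have hIcc : ∫⁻ x in Icc 0 t, truncMean μ (t - x) ∂(renewalMeasure μ)
      = ∫⁻ x, truncMean μ (t - x) ∂(renewalMeasure μ) := by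
    rw [← lintegral_indicator measurableSet_Icc]
    refine lintegral_congr_ae (hν.mono fun x hx => ?_)
    by_cases hxt : x ≤ t
    · exact indicator_of_mem (mem_Icc.2 ⟨hx, hxt⟩) _
    · refine (indicator_of_notMem (fun h => hxt h.2) _).trans (le_antisymm zero_le ?_)
      exact (truncMean_le μ _).trans_eq (ENNReal.ofReal_of_nonpos (by linarith))
  rw [hIcc, renewalMeasure, lintegral_sum_measure, ← tsum_lintegral_truncMean μ hμ t hfin,
    tsum_eq_zero_add' (f := fun n => ∫⁻ x, truncMean μ (t - x) ∂(convPow μ n)) ENNReal.summable]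
  simp [convPow]

theorem truncMean_eq_lintegral_Ioi (μ : Measure ℝ) (hμ : ∀ᵐ x ∂μ, 0 ≤ x) {s : ℝ} (hs : 0 ≤ s) :
    truncMean μ s = ∫⁻ u in Ioc 0 s, μ (Ioi u) := by
  rw [truncMean, lintegral_eq_lintegral_meas_lt μ (hμ.mono fun y hy => le_min hs hy)
    (by fun_prop), setLIntegral_congr Ioo_ae_eq_Ioc.symm, ← lintegral_indicator measurableSet_Ioi,
    ← lintegral_indicator measurableSet_Ioo]
  refine lintegral_congr fun u => ?_
  by_cases hu : 0 < u <;> by_cases hus : u < s <;> simp [indicator, hu, hus, Ioi]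

theorem integral_one_sub_cdf_eq_truncMean (μ : Measure ℝ) [IsProbabilityMeasure μ]
    (hμ : ∀ᵐ x ∂μ, 0 ≤ x) {s : ℝ} (hs : 0 ≤ s) :
    ∫ u in (0 : ℝ)..s, (1 - (μ (Icc 0 u)).toReal) = (truncMean μ s).toReal := by
  have hcongr : ∀ u, 1 - (μ (Icc 0 u)).toReal = (μ (Ioi u)).toReal := fun u => by
    have hIcc : μ (Icc 0 u) = μ (Iic u) :=
      measure_congr (hμ.mono fun x hx => propext ⟨fun h => h.2, fun h => ⟨hx, h⟩⟩)
    rw [hIcc, ← compl_Iic]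
    exact (probReal_compl_eq_one_sub measurableSet_Iic).symm
  have hmeas : Measurable fun u => μ (Ioi u) :=
    Antitone.measurable fun a b h => measure_mono (Ioi_subset_Ioi h)
  simp_rw [hcongr]
  rw [intervalIntegral.integral_of_le hs, integral_toReal hmeas.aemeasurable
    (Eventually.of_forall fun u => measure_lt_top μ _), truncMean_eq_lintegral_Ioi μ hμ hs]

/-- The key renewal identity used in Corollary 5.2:
`F_e(t) + ∫_{[0,t]} F_e(t-s) dν(s) = t` where `ν` is the renewal measure of `μ`. -/
theorem stmt_7
    (μ : Measure ℝ) [IsProbabilityMeasure μ] (hμsupp : μ (Iio (0 : ℝ)) = 0)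
    (hmean : ∫ u in Ici (0 : ℝ), u ∂μ = 1)
    (h0 : μ {(0 : ℝ)} < 1)
    (F G Fe : ℝ → ℝ)
    (hF : ∀ t, F t = (μ (Icc (0 : ℝ) t)).toReal)
    (hG : ∀ t, G t = 1 - F t)
    (hFe : ∀ t, Fe t = ∫ u in (0 : ℝ)..t, G u)
    (ν : Measure ℝ) (hν : ν = renewalMeasure μ)
    (hνfin : ∀ t, 0 ≤ t → ν (Icc (0 : ℝ) t) < ⊤)
    (t : ℝ) (ht : 0 ≤ t) :
    Fe t + ∫ s in Icc (0 : ℝ) t, Fe (t - s) ∂ν = t := by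
  have hμ : ∀ᵐ x ∂μ, 0 ≤ x := by
    simpa only [ae_iff, not_le] using! hμsupp
  have hFe' : ∀ s, 0 ≤ s → Fe s = (truncMean μ s).toReal := fun s hs => by
    rw [hFe, ← integral_one_sub_cdf_eq_truncMean μ hμ hs]
    simp_rw [hG, hF]
  have hlt : ∀ s, truncMean μ s < ⊤ := fun s => (truncMean_le μ s).trans_lt ENNReal.ofReal_lt_top
  have hfin := hνfin t ht
  subst hν
  have key := truncMean_add_lintegral_renewalMeasure μ hμ t hfin
  have hlt' : ∫⁻ x in Icc 0 t, truncMean μ (t - x) ∂(renewalMeasure μ) ≠ ⊤ :=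
    ((le_add_self.trans_eq key).trans_lt ENNReal.ofReal_lt_top).ne
  rw [setIntegral_congr_fun measurableSet_Icc fun x hx => hFe' (t - x) (sub_nonneg.2 hx.2),
    integral_toReal (by fun_prop)
      (Eventually.of_forall fun x => hlt _), hFe' t ht, ← ENNReal.toReal_add (hlt t).ne hlt', key,
    ENNReal.toReal_ofReal ht]
end
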